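/- The graded Betti numbers of the cut ideal of the binary tree of depth n satisfy beta_{i,i+j}(J_{2,n}) = M_{n+1,j+1} * binomial(j-1, i-1), where M_{n,j} is the coefficient of q^j in the Mandelbrot polynomial z_n(q). -/

import Mathlib

open MvPolynomial

/-- The Mandelbrot polynomials `z_0(q) = 0`, `z_n(q) = z_{n-1}(q)^2 + q`;
`(mandelbrot n).coeff j` is the Mandelbrot number `M_{n,j}`. -/
noncomputable def mandelbrot : ℕ → Polynomial ℕ
  | 0 => 0
  | n + 1 => (mandelbrot n) ^ 2 + Polynomial.X

/-- Edges of the complete `k`-ary tree of depth `n`. -/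
abbrev TreeEdge (k n : ℕ) := Σ i : Fin n, (Fin (i.1 + 1) → Fin k)

/-- Leaves of the complete `k`-ary tree of depth `n`. -/
abbrev TreeLeaf (k n : ℕ) := Fin n → Fin k

/-- The edge at depth `i+1` on the root-to-leaf path of the leaf `ℓ`. -/
def pathEdge {k n : ℕ} (ℓ : TreeLeaf k n) (i : Fin n) : TreeEdge k n :=
  ⟨i, fun t => ℓ ⟨t.1, lt_of_lt_of_le t.2 i.2⟩⟩

/-- The squarefree monomial of the unique root-to-leaf path of the leaf `ℓ`. -/
noncomputable def pathMonomial (K : Type) [Field K] {k n : ℕ} (ℓ : TreeLeaf k n) :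
    MvPolynomial (TreeEdge k n) K :=
  ∏ i : Fin n, X (pathEdge ℓ i)

/-- `C` is a cut of the complete `k`-ary tree: every root-to-leaf path meets `C`. -/
def TreeIsCut {k n : ℕ} (C : Finset (TreeEdge k n)) : Prop :=
  ∀ ℓ : TreeLeaf k n, ∃ i : Fin n, pathEdge ℓ i ∈ C

/-- `C` is a minimal cut of the complete `k`-ary tree. -/
def TreeMinCut {k n : ℕ} (C : Finset (TreeEdge k n)) : Prop :=
  TreeIsCut C ∧ ∀ C' ⊆ C, TreeIsCut C' → C' = C

/-- The cut ideal `J_{k,n}` of the complete `k`-ary tree (the Alexander dual of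
the path ideal): it is generated by the squarefree monomials of minimal cuts. -/
noncomputable def cutIdeal (K : Type) [Field K] (k n : ℕ) :
    Ideal (MvPolynomial (TreeEdge k n) K) :=
  Ideal.span { m | ∃ C : Finset (TreeEdge k n), TreeMinCut C ∧ m = ∏ e ∈ C, X e }

/-- A minimal graded free resolution of `S/I` with graded Betti numbers `b i j`. -/
structure MinGradedFreeRes (K : Type) [Field K] (σ : Type)
    (I : Ideal (MvPolynomial σ K)) (b : ℕ → ℕ → ℕ) : Type where
  d : ∀ i : ℕ,
    ((Σ j : ℕ, Fin (b (i + 1) j)) →₀ MvPolynomial σ K) →ₗ[MvPolynomial σ K]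
    ((Σ j : ℕ, Fin (b i j)) →₀ MvPolynomial σ K)
  aug : ((Σ j : ℕ, Fin (b 0 j)) →₀ MvPolynomial σ K) →ₗ[MvPolynomial σ K]
    (MvPolynomial σ K ⧸ I)
  aug_surjective : Function.Surjective aug
  exact_zero : LinearMap.ker aug = LinearMap.range (d 0)
  exact : ∀ i, LinearMap.ker (d i) = LinearMap.range (d (i + 1))
  graded : ∀ (i : ℕ) (v : Σ j : ℕ, Fin (b (i + 1) j)) (w : Σ j : ℕ, Fin (b i j)),
    (d i (Finsupp.single v 1)) w ≠ 0 →
      w.1 ≤ v.1 ∧ ((d i (Finsupp.single v 1)) w).IsHomogeneous (v.1 - w.1)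
  graded_aug : ∀ v : Σ j : ℕ, Fin (b 0 j), ∃ g : MvPolynomial σ K,
    g.IsHomogeneous v.1 ∧ aug (Finsupp.single v 1) = Ideal.Quotient.mk I g
  minimal : ∀ (i : ℕ) (v : Σ j : ℕ, Fin (b (i + 1) j)) (w : Σ j : ℕ, Fin (b i j)),
    constantCoeff ((d i (Finsupp.single v 1)) w) = 0
  betti_finite : (Function.support fun p : ℕ × ℕ => b p.1 p.2).Finite

section GradedFree

variable {K : Type} [Field K] {σ : Type}

/-- An element of the free module on `A` is homogeneous of degree `e` when the basis vector `a`
is placed in degree `deg a`. -/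
def FreeHomog {A : Type} (deg : A → ℕ) (e : ℕ) (y : A →₀ MvPolynomial σ K) : Prop :=
  ∀ a s, coeff s (y a) ≠ 0 → deg a + s.degree = e

/-- A linear map of graded free modules which preserves degrees. -/
def GradedMap {A B : Type} (degA : A → ℕ) (degB : B → ℕ)
    (f : (A →₀ MvPolynomial σ K) →ₗ[MvPolynomial σ K] (B →₀ MvPolynomial σ K)) : Prop :=
  ∀ a, FreeHomog degB (degA a) (f (Finsupp.single a 1))

/-- The projection of a graded free module onto its component of degree `e`. -/
noncomputable def freeComp {A : Type} (deg : A → ℕ) (e : ℕ) :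
    (A →₀ MvPolynomial σ K) →ₗ[K] (A →₀ MvPolynomial σ K) :=
  Finsupp.lsum K fun a => (Finsupp.lsingle a) ∘ₗ
    (if deg a ≤ e then homogeneousComponent (e - deg a) else 0)

theorem coeff_freeComp {A : Type} (deg : A → ℕ) (e : ℕ) (y : A →₀ MvPolynomial σ K)
    (a : A) (s : σ →₀ ℕ) :
    coeff s (freeComp deg e y a) = if deg a + s.degree = e then coeff s (y a) else 0 := by
  classical
  induction y using Finsupp.induction_linear with
  | zero => simp
  | add y z hy hz =>
    rw [map_add, Finsupp.add_apply, coeff_add, hy, hz, Finsupp.add_apply, coeff_add]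
    split_ifs <;> simp
  | single b p =>
    simp only [freeComp, Finsupp.lsum_single, LinearMap.comp_apply, Finsupp.lsingle_apply,
      Finsupp.single_apply]
    by_cases hab : b = a
    · subst hab
      by_cases h : deg b ≤ e
      · simp only [h, if_true, coeff_homogeneousComponent]
        congr 1
        exact propext ⟨fun h' => by omega, fun h' => by omega⟩
      · have : ¬ (deg b + s.degree = e) := by omega
        simp [h, this]
    · simp [hab]

theorem freeHomog_freeComp {A : Type} (deg : A → ℕ) (e : ℕ) (y : A →₀ MvPolynomial σ K) :
    FreeHomog deg e (freeComp deg e y) := by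
  intro a s h
  rw [coeff_freeComp] at h
  by_contra hne
  simp [hne] at h

theorem FreeHomog.freeComp_eq {A : Type} {deg : A → ℕ} {e : ℕ} {y : A →₀ MvPolynomial σ K}
    (h : FreeHomog deg e y) : freeComp deg e y = y := by
  ext a s
  rw [coeff_freeComp, ite_eq_left_iff]
  intro hne
  by_contra h0
  exact hne (h a s (Ne.symm h0))

theorem FreeHomog.freeComp_eq_zero {A : Type} {deg : A → ℕ} {e e' : ℕ}
    {y : A →₀ MvPolynomial σ K} (h : FreeHomog deg e' y) (hne : e' ≠ e) :
    freeComp deg e y = 0 := by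
  ext a s
  rw [coeff_freeComp, Finsupp.zero_apply, coeff_zero, ite_eq_right_iff]
  intro he
  by_contra h0
  exact hne ((h a s h0).symm.trans he)

theorem FreeHomog.monomial_smul {A : Type} {deg : A → ℕ} {e : ℕ}
    {y : A →₀ MvPolynomial σ K} (h : FreeHomog deg e y) (s : σ →₀ ℕ) (c : K) :
    FreeHomog deg (e + s.degree) (monomial s c • y) := by
  classical
  intro a t ht
  rw [Finsupp.smul_apply, smul_eq_mul, coeff_monomial_mul'] at ht
  split_ifs at ht with hst
  · have h1 := h a (t - s) (right_ne_zero_of_mul ht)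
    have h2 : (t - s).degree + s.degree = t.degree := by
      rw [← map_add, tsub_add_cancel_of_le hst]
    omega
  · exact absurd rfl ht

theorem single_monomial {A : Type} (a : A) (s : σ →₀ ℕ) (c : K) :
    (Finsupp.single a (monomial s c) : A →₀ MvPolynomial σ K) =
      monomial s c • Finsupp.single a 1 := by
  rw [Finsupp.smul_single, smul_eq_mul, mul_one]

theorem freeHomog_single_one {A : Type} (deg : A → ℕ) (a : A) :
    FreeHomog deg (deg a) (Finsupp.single a (1 : MvPolynomial σ K)) := by
  classical
  intro b s h
  rw [Finsupp.single_apply] at h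
  split_ifs at h with hab
  · rw [coeff_one] at h
    split_ifs at h with hs
    · subst hs hab
      simp
    · exact absurd rfl h
  · simp at h

theorem GradedMap.map_freeComp {A B : Type} {degA : A → ℕ} {degB : B → ℕ}
    {f : (A →₀ MvPolynomial σ K) →ₗ[MvPolynomial σ K] (B →₀ MvPolynomial σ K)}
    (hf : GradedMap degA degB f) (e : ℕ) (y : A →₀ MvPolynomial σ K) :
    f (freeComp degA e y) = freeComp degB e (f y) := by
  induction y using Finsupp.induction_linear with
  | zero => simp
  | add y z hy hz => simp only [map_add, hy, hz]
  | single a p =>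
    induction p using MvPolynomial.induction_on' with
    | monomial s c =>
      rw [single_monomial]
      have h1 := (freeHomog_single_one (K := K) (σ := σ) degA a).monomial_smul s c
      have h2 := (hf a).monomial_smul s c
      rw [← map_smul] at h2
      by_cases he : degA a + s.degree = e
      · subst he
        rw [h1.freeComp_eq, h2.freeComp_eq]
      · rw [h1.freeComp_eq_zero he, h2.freeComp_eq_zero he, map_zero]
    | add p q hp hq => simp only [Finsupp.single_add, map_add, hp, hq]

theorem GradedMap.map_freeHomog {A B : Type} {degA : A → ℕ} {degB : B → ℕ}
    {f : (A →₀ MvPolynomial σ K) →ₗ[MvPolynomial σ K] (B →₀ MvPolynomial σ K)}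
    (hf : GradedMap degA degB f) {e : ℕ} {y : A →₀ MvPolynomial σ K} (hy : FreeHomog degA e y) :
    FreeHomog degB e (f y) := by
  rw [← hy.freeComp_eq, hf.map_freeComp]
  exact freeHomog_freeComp _ _ _

theorem GradedMap.comp {A B C : Type} {degA : A → ℕ} {degB : B → ℕ} {degC : C → ℕ}
    {g : (B →₀ MvPolynomial σ K) →ₗ[MvPolynomial σ K] (C →₀ MvPolynomial σ K)}
    {f : (A →₀ MvPolynomial σ K) →ₗ[MvPolynomial σ K] (B →₀ MvPolynomial σ K)}
    (hg : GradedMap degB degC g) (hf : GradedMap degA degB f) :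
    GradedMap degA degC (g ∘ₗ f) :=
  fun a => hg.map_freeHomog (hf a)

/-- A linear map with values in the range of `d` factors through `d`. -/
theorem exists_lift {A B C : Type}
    (f : (A →₀ MvPolynomial σ K) →ₗ[MvPolynomial σ K] (C →₀ MvPolynomial σ K))
    (d : (B →₀ MvPolynomial σ K) →ₗ[MvPolynomial σ K] (C →₀ MvPolynomial σ K))
    (h : ∀ y, f y ∈ LinearMap.range d) :
    ∃ g : (A →₀ MvPolynomial σ K) →ₗ[MvPolynomial σ K] (B →₀ MvPolynomial σ K),
      ∀ y, d (g y) = f y := by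
  choose t ht using h
  refine ⟨Finsupp.linearCombination _ fun a => t (Finsupp.single a 1), fun y => ?_⟩
  have : d ∘ₗ Finsupp.linearCombination _ (fun a => t (Finsupp.single a 1)) = f := by
    ext a : 2
    simp [ht]
  exact LinearMap.congr_fun this y

/-- A graded map with values in the range of a graded map `d` has a graded lift along `d`. -/
theorem exists_graded_lift {A B C : Type} {degA : A → ℕ} {degB : B → ℕ} {degC : C → ℕ}
    {f : (A →₀ MvPolynomial σ K) →ₗ[MvPolynomial σ K] (C →₀ MvPolynomial σ K)}
    {d : (B →₀ MvPolynomial σ K) →ₗ[MvPolynomial σ K] (C →₀ MvPolynomial σ K)}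
    (hf : GradedMap degA degC f) (hd : GradedMap degB degC d)
    (h : ∀ y, f y ∈ LinearMap.range d) :
    ∃ g : (A →₀ MvPolynomial σ K) →ₗ[MvPolynomial σ K] (B →₀ MvPolynomial σ K),
      GradedMap degA degB g ∧ ∀ y, d (g y) = f y := by
  choose t ht using h
  refine ⟨Finsupp.linearCombination _ fun a =>
    freeComp degB (degA a) (t (Finsupp.single a 1)), fun a => ?_, fun y => ?_⟩
  · rw [Finsupp.linearCombination_single, one_smul]
    exact freeHomog_freeComp _ _ _
  · have : d ∘ₗ Finsupp.linearCombination _ (fun a =>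
        freeComp degB (degA a) (t (Finsupp.single a 1))) = f := by
      ext a : 2
      simp only [LinearMap.comp_apply, Finsupp.lsingle_apply, Finsupp.linearCombination_single,
        one_smul, hd.map_freeComp, ht]
      exact (hf a).freeComp_eq
    exact LinearMap.congr_fun this y

theorem constantCoeff_map_eq_zero {A B : Type}
    (f : (A →₀ MvPolynomial σ K) →ₗ[MvPolynomial σ K] (B →₀ MvPolynomial σ K))
    {y : A →₀ MvPolynomial σ K} (hy : ∀ a, constantCoeff (y a) = 0) (b : B) :
    constantCoeff (f y b) = 0 := by
  rw [← Finsupp.sum_single y, Finsupp.sum, map_sum, Finsupp.finsetSum_apply, map_sum]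
  refine Finset.sum_eq_zero fun a _ => ?_
  rw [← mul_one (y a), ← smul_eq_mul, ← Finsupp.smul_single, map_smul, Finsupp.smul_apply,
    smul_eq_mul, map_mul, hy, zero_mul]

theorem constantCoeff_map_eq_zero_of_single {A B : Type}
    {f : (A →₀ MvPolynomial σ K) →ₗ[MvPolynomial σ K] (B →₀ MvPolynomial σ K)}
    (hf : ∀ a b, constantCoeff (f (Finsupp.single a 1) b) = 0) (y : A →₀ MvPolynomial σ K)
    (b : B) : constantCoeff (f y b) = 0 := by
  rw [← Finsupp.sum_single y, Finsupp.sum, map_sum, Finsupp.finsetSum_apply, map_sum]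
  refine Finset.sum_eq_zero fun a _ => ?_
  rw [← mul_one (y a), ← smul_eq_mul, ← Finsupp.smul_single, map_smul, Finsupp.smul_apply,
    smul_eq_mul, map_mul, hf, mul_zero]

/-- The first `ℓ` steps of a minimal graded free resolution, with graded Betti numbers `b`, of the
submodule `N` of a graded free module. -/
def HasMinRes : ℕ → ∀ {A : Type}, (A → ℕ) →
    Submodule (MvPolynomial σ K) (A →₀ MvPolynomial σ K) → (ℕ → ℕ → ℕ) → Prop
  | 0, _, _, _, _ => True
  | ℓ + 1, A, degA, N, b => (∀ y ∈ N, ∀ a, constantCoeff (y a) = 0) ∧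
      ∃ (B : Type) (degB : B → ℕ)
        (d : (B →₀ MvPolynomial σ K) →ₗ[MvPolynomial σ K] (A →₀ MvPolynomial σ K)),
        GradedMap degB degA d ∧ LinearMap.range d = N ∧
        (∀ j, Nonempty ({v // degB v = j} ≃ Fin (b 0 j))) ∧
        HasMinRes ℓ degB (LinearMap.ker d) fun i => b (i + 1)

/-- A graded map between graded free modules which is injective modulo the variables gives
an inequality between the numbers of basis vectors in each degree. -/
theorem card_le_of_constantCoeff_injective {B B' : Type} {degB : B → ℕ} {degB' : B' → ℕ}
    {f : (B →₀ MvPolynomial σ K) →ₗ[MvPolynomial σ K] (B' →₀ MvPolynomial σ K)}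
    (hf : GradedMap degB degB' f)
    (hinj : ∀ x, (∀ u, constantCoeff (f x u) = 0) → ∀ v, constantCoeff (x v) = 0)
    {j m m' : ℕ} (e : {v // degB v = j} ≃ Fin m) (e' : {v // degB' v = j} ≃ Fin m') :
    m ≤ m' := by
  classical
  have hli : LinearIndependent K fun (p : Fin m) (q : Fin m') =>
      constantCoeff (f (Finsupp.single (e.symm p).1 1) (e'.symm q).1) := by
    rw [Fintype.linearIndependent_iff]
    intro c hc p
    set x : B →₀ MvPolynomial σ K := ∑ p, Finsupp.single (e.symm p).1 (C (c p)) with hx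
    have hfx : ∀ u, constantCoeff (f x u) =
        ∑ p, c p * constantCoeff (f (Finsupp.single (e.symm p).1 1) u) := by
      intro u
      rw [hx, map_sum, Finsupp.finsetSum_apply, map_sum]
      refine Finset.sum_congr rfl fun p _ => ?_
      rw [← mul_one (C (c p)), ← smul_eq_mul, ← Finsupp.smul_single, map_smul,
        Finsupp.smul_apply, smul_eq_mul, map_mul, constantCoeff_C]
    have h0 : ∀ u, constantCoeff (f x u) = 0 := by
      intro u
      rw [hfx]
      by_cases hu : degB' u = j
      · have := congrFun hc (e' ⟨u, hu⟩)
        simpa using this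
      · refine Finset.sum_eq_zero fun p _ => ?_
        have : constantCoeff (f (Finsupp.single (e.symm p).1 1) u) = 0 := by
          by_contra hne
          have := hf _ u 0 hne
          rw [map_zero, add_zero, (e.symm p).2] at this
          exact hu this
        rw [this, mul_zero]
    have h1 := hinj x h0 (e.symm p).1
    rw [hx, Finsupp.finsetSum_apply, map_sum, Finset.sum_eq_single p] at h1
    · simpa using h1
    · intro q _ hq
      rw [Finsupp.single_eq_of_ne, map_zero]
      intro h
      exact hq (e.symm.injective (Subtype.ext h.symm))
    · simp
  simpa using hli.fintype_card_le_finrank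

/-- Comparison maps, together with a homotopy, lift along presentations. -/
theorem exists_homotopy_lift {A A' B B' : Type} {degA : A → ℕ} {degA' : A' → ℕ}
    {degB : B → ℕ} {degB' : B' → ℕ}
    {d : (B →₀ MvPolynomial σ K) →ₗ[MvPolynomial σ K] (A →₀ MvPolynomial σ K)}
    {d' : (B' →₀ MvPolynomial σ K) →ₗ[MvPolynomial σ K] (A' →₀ MvPolynomial σ K)}
    (hd : GradedMap degB degA d) (hd' : GradedMap degB' degA' d')
    {α : (A →₀ MvPolynomial σ K) →ₗ[MvPolynomial σ K] (A' →₀ MvPolynomial σ K)}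
    {β : (A' →₀ MvPolynomial σ K) →ₗ[MvPolynomial σ K] (A →₀ MvPolynomial σ K)}
    {h : (A →₀ MvPolynomial σ K) →ₗ[MvPolynomial σ K] (A →₀ MvPolynomial σ K)}
    (hα : GradedMap degA degA' α) (hβ : GradedMap degA' degA β)
    (hαN : ∀ y ∈ LinearMap.range d, α y ∈ LinearMap.range d')
    (hβN : ∀ y ∈ LinearMap.range d', β y ∈ LinearMap.range d)
    (hh : ∀ y ∈ LinearMap.range d, h y = 0)
    (hN : ∀ y, β (α y) - y - h y ∈ LinearMap.range d) :
    ∃ (α₁ : (B →₀ MvPolynomial σ K) →ₗ[MvPolynomial σ K] (B' →₀ MvPolynomial σ K))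
      (β₁ : (B' →₀ MvPolynomial σ K) →ₗ[MvPolynomial σ K] (B →₀ MvPolynomial σ K))
      (s : (A →₀ MvPolynomial σ K) →ₗ[MvPolynomial σ K] (B →₀ MvPolynomial σ K)),
      GradedMap degB degB' α₁ ∧ GradedMap degB' degB β₁ ∧
      (∀ y ∈ LinearMap.ker d, α₁ y ∈ LinearMap.ker d') ∧
      (∀ y ∈ LinearMap.ker d', β₁ y ∈ LinearMap.ker d) ∧
      ∀ y, β₁ (α₁ y) - y - s (d y) ∈ LinearMap.ker d := by
  obtain ⟨α₁, hα₁, hα₁d⟩ := exists_graded_lift (hα.comp hd) hd' fun y => hαN _ ⟨y, rfl⟩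
  obtain ⟨β₁, hβ₁, hβ₁d⟩ := exists_graded_lift (hβ.comp hd') hd fun y => hβN _ ⟨y, rfl⟩
  obtain ⟨s, hs⟩ := exists_lift (β ∘ₗ α - LinearMap.id - h) d fun y => hN y
  refine ⟨α₁, β₁, s, hα₁, hβ₁, fun y hy => ?_, fun y hy => ?_, fun y => ?_⟩
  · rw [LinearMap.mem_ker] at hy ⊢
    simp [hα₁d, hy]
  · rw [LinearMap.mem_ker] at hy ⊢
    simp [hβ₁d, hy]
  · have h0 := hh (d y) ⟨y, rfl⟩
    simp [LinearMap.mem_ker, hα₁d, hβ₁d, hs, h0]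

/-- Two minimal graded free resolutions of submodules which agree up to homotopy
have comparable graded Betti numbers. -/
theorem HasMinRes.betti_le (ℓ : ℕ) : ∀ {A A' : Type} {degA : A → ℕ} {degA' : A' → ℕ}
    {N : Submodule (MvPolynomial σ K) (A →₀ MvPolynomial σ K)}
    {N' : Submodule (MvPolynomial σ K) (A' →₀ MvPolynomial σ K)} {b b' : ℕ → ℕ → ℕ},
    HasMinRes (ℓ + 2) degA N b → HasMinRes (ℓ + 2) degA' N' b' →
    ∀ (α : (A →₀ MvPolynomial σ K) →ₗ[MvPolynomial σ K] (A' →₀ MvPolynomial σ K))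
      (β : (A' →₀ MvPolynomial σ K) →ₗ[MvPolynomial σ K] (A →₀ MvPolynomial σ K))
      (h : (A →₀ MvPolynomial σ K) →ₗ[MvPolynomial σ K] (A →₀ MvPolynomial σ K)),
      GradedMap degA degA' α → GradedMap degA' degA β →
      (∀ y ∈ N, α y ∈ N') → (∀ y ∈ N', β y ∈ N) → (∀ y ∈ N, h y = 0) →
      (∀ y, β (α y) - y - h y ∈ N) → ∀ j, b ℓ j ≤ b' ℓ j := by
  induction ℓ with
  | zero =>
    intro A A' degA degA' N N' b b' hN hN' α β h hα hβ hαN hβN hh hN0 j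
    obtain ⟨hmin, B, degB, d, hd, hdN, hcard, hnext⟩ := hN
    obtain ⟨hmin', B', degB', d', hd', hdN', hcard', hnext'⟩ := hN'
    subst hdN hdN'
    obtain ⟨α₁, β₁, s, hα₁, hβ₁, -, -, hs⟩ := exists_homotopy_lift hd hd' hα hβ hαN hβN hh hN0
    obtain ⟨e⟩ := hcard j
    obtain ⟨e'⟩ := hcard' j
    refine card_le_of_constantCoeff_injective hα₁ (fun x hx v => ?_) e e'
    have h1 := hnext.1 _ (hs x) v
    have h2 := constantCoeff_map_eq_zero β₁ hx v
    have h3 := constantCoeff_map_eq_zero s (hmin (d x) ⟨x, rfl⟩) v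
    rw [Finsupp.sub_apply, Finsupp.sub_apply, map_sub, map_sub, h2, h3] at h1
    simpa using h1
  | succ ℓ ih =>
    intro A A' degA degA' N N' b b' hN hN' α β h hα hβ hαN hβN hh hN0 j
    obtain ⟨hmin, B, degB, d, hd, hdN, hcard, hnext⟩ := hN
    obtain ⟨hmin', B', degB', d', hd', hdN', hcard', hnext'⟩ := hN'
    subst hdN hdN'
    obtain ⟨α₁, β₁, s, hα₁, hβ₁, hαk, hβk, hs⟩ :=
      exists_homotopy_lift hd hd' hα hβ hαN hβN hh hN0
    refine ih hnext hnext' α₁ β₁ (s ∘ₗ d) hα₁ hβ₁ hαk hβk (fun y hy => ?_) hs j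
    rw [LinearMap.comp_apply, LinearMap.mem_ker.1 hy, map_zero]

/-- A submodule of a graded free module which contains the homogeneous components of its
elements. -/
def GradedSub {A : Type} (deg : A → ℕ)
    (N : Submodule (MvPolynomial σ K) (A →₀ MvPolynomial σ K)) : Prop :=
  ∀ y ∈ N, ∀ e, freeComp deg e y ∈ N

theorem GradedMap.gradedSub_ker {A B : Type} {degA : A → ℕ} {degB : B → ℕ}
    {f : (A →₀ MvPolynomial σ K) →ₗ[MvPolynomial σ K] (B →₀ MvPolynomial σ K)}
    (hf : GradedMap degA degB f) : GradedSub degA (LinearMap.ker f) := by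
  intro y hy e
  rw [LinearMap.mem_ker] at hy ⊢
  rw [hf.map_freeComp, hy, map_zero]

theorem GradedMap.gradedSub_range {A B : Type} {degA : A → ℕ} {degB : B → ℕ}
    {f : (A →₀ MvPolynomial σ K) →ₗ[MvPolynomial σ K] (B →₀ MvPolynomial σ K)}
    (hf : GradedMap degA degB f) : GradedSub degB (LinearMap.range f) := by
  rintro _ ⟨y, rfl⟩ e
  exact ⟨freeComp degA e y, hf.map_freeComp e y⟩

/-- The inclusion of the free module on `A` into the free module on `A ⊕ B`. -/
noncomputable def freeInl (K σ A B : Type) [Field K] :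
    (A →₀ MvPolynomial σ K) →ₗ[MvPolynomial σ K] (A ⊕ B →₀ MvPolynomial σ K) :=
  Finsupp.lmapDomain _ _ Sum.inl

/-- The projection of the free module on `A ⊕ B` onto the free module on `B`. -/
noncomputable def freeSnd (K σ A B : Type) [Field K] :
    (A ⊕ B →₀ MvPolynomial σ K) →ₗ[MvPolynomial σ K] (B →₀ MvPolynomial σ K) :=
  Finsupp.lcomapDomain Sum.inr Sum.inr_injective

theorem freeInl_single {A B : Type} (a : A) (p : MvPolynomial σ K) :
    freeInl K σ A B (Finsupp.single a p) = Finsupp.single (Sum.inl a) p :=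
  Finsupp.mapDomain_single

theorem freeInl_inl {A B : Type} (x : A →₀ MvPolynomial σ K) (a : A) :
    freeInl K σ A B x (Sum.inl a) = x a :=
  Finsupp.mapDomain_apply Sum.inl_injective x a

theorem freeInl_inr {A B : Type} (x : A →₀ MvPolynomial σ K) (b : B) :
    freeInl K σ A B x (Sum.inr b) = 0 :=
  Finsupp.mapDomain_of_notMem_range x _ (by simp)

theorem freeSnd_apply {A B : Type} (y : A ⊕ B →₀ MvPolynomial σ K) (b : B) :
    freeSnd K σ A B y b = y (Sum.inr b) := rfl

theorem freeSnd_freeInl {A B : Type} (x : A →₀ MvPolynomial σ K) :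
    freeSnd K σ A B (freeInl K σ A B x) = 0 := by
  ext1 b
  exact freeInl_inr x b

theorem freeSnd_single_inr {A B : Type} (b : B) (p : MvPolynomial σ K) :
    freeSnd K σ A B (Finsupp.single (Sum.inr b) p) = Finsupp.single b p := by
  classical
  ext1 c
  rw [freeSnd_apply, Finsupp.single_apply, Finsupp.single_apply]
  simp

theorem exists_freeInl_eq {A B : Type} {y : A ⊕ B →₀ MvPolynomial σ K}
    (h : freeSnd K σ A B y = 0) : ∃ x, freeInl K σ A B x = y := by
  refine ⟨Finsupp.comapDomain Sum.inl y Sum.inl_injective.injOn, ?_⟩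
  ext1 c
  cases c with
  | inl a => rw [freeInl_inl]; rfl
  | inr b => rw [freeInl_inr, ← freeSnd_apply, h]; rfl

theorem freeInl_injective {A B : Type} : Function.Injective (freeInl K σ A B) :=
  Finsupp.mapDomain_injective Sum.inl_injective

/-- The map from the free module on `A ⊕ B` which is `f` on `A` and sends the basis vectors
in `B` to `t`. -/
noncomputable def freeCoprod {A B C : Type}
    (f : (A →₀ MvPolynomial σ K) →ₗ[MvPolynomial σ K] (C →₀ MvPolynomial σ K))
    (t : B → (C →₀ MvPolynomial σ K)) :
    (A ⊕ B →₀ MvPolynomial σ K) →ₗ[MvPolynomial σ K] (C →₀ MvPolynomial σ K) :=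
  Finsupp.linearCombination _ (Sum.elim (fun a => f (Finsupp.single a 1)) t)

theorem freeCoprod_freeInl {A B C : Type}
    (f : (A →₀ MvPolynomial σ K) →ₗ[MvPolynomial σ K] (C →₀ MvPolynomial σ K))
    (t : B → (C →₀ MvPolynomial σ K)) (x : A →₀ MvPolynomial σ K) :
    freeCoprod f t (freeInl K σ A B x) = f x := by
  have : freeCoprod f t ∘ₗ freeInl K σ A B = f := by
    ext a : 2
    simp [freeCoprod, freeInl_single]
  exact LinearMap.congr_fun this x

theorem gradedMap_freeCoprod {A B C : Type} {degA : A → ℕ} {degB : B → ℕ} {degC : C → ℕ}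
    {f : (A →₀ MvPolynomial σ K) →ₗ[MvPolynomial σ K] (C →₀ MvPolynomial σ K)}
    {t : B → (C →₀ MvPolynomial σ K)} (hf : GradedMap degA degC f)
    (ht : ∀ b, FreeHomog degC (degB b) (t b)) :
    GradedMap (Sum.elim degA degB) degC (freeCoprod f t) := by
  rintro (a | b)
  · simpa [freeCoprod] using hf a
  · simpa [freeCoprod] using ht b

theorem nonempty_sum_fiber_equiv {A B : Type} {degA : A → ℕ} {degB : B → ℕ} {j m m' : ℕ}
    (e : {v // degA v = j} ≃ Fin m) (e' : {v // degB v = j} ≃ Fin m') :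
    Nonempty ({v // Sum.elim degA degB v = j} ≃ Fin (m + m')) :=
  ⟨(Equiv.subtypeSum (p := fun v => Sum.elim degA degB v = j)).trans
    ((Equiv.sumCongr e e').trans finSumFinEquiv)⟩

theorem freeSnd_freeComp {A B : Type} (degA : A → ℕ) (degB : B → ℕ) (e : ℕ)
    (y : A ⊕ B →₀ MvPolynomial σ K) :
    freeSnd K σ A B (freeComp (Sum.elim degA degB) e y) =
      freeComp degB e (freeSnd K σ A B y) := by
  ext b s
  rw [freeSnd_apply, coeff_freeComp, coeff_freeComp, freeSnd_apply, Sum.elim_inr]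

/-- The horseshoe lemma, in a range of degrees where the resulting resolution is minimal. -/
theorem HasMinRes.horseshoe (ℓ : ℕ) : ∀ {A B : Type} {degA : A → ℕ} {degB : B → ℕ}
    {N : Submodule (MvPolynomial σ K) (A ⊕ B →₀ MvPolynomial σ K)} {b₁ b₂ : ℕ → ℕ → ℕ} {c : ℕ},
    GradedSub (Sum.elim degA degB) N →
    HasMinRes ℓ degA (N.comap (freeInl K σ A B)) b₁ →
    HasMinRes ℓ degB (N.map (freeSnd K σ A B)) b₂ →
    (∀ a, degA a ≤ c) → (∀ i j, b₁ i j ≠ 0 → j ≤ c + 1 + i) →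
    (∀ i j, b₂ i j ≠ 0 → c + i < j) →
    HasMinRes ℓ (Sum.elim degA degB) N fun i j => b₁ i j + b₂ i j := by
  induction ℓ with
  | zero => intros; trivial
  | succ ℓ ih =>
    intro A B degA degB N b₁ b₂ c hN h₁ h₂ hA hb₁ hb₂
    obtain ⟨hmin₁, F, degF, d₁, hd₁, hr₁, hcard₁, hnext₁⟩ := h₁
    obtain ⟨hmin₂, G, degG, d₂, hd₂, hr₂, hcard₂, hnext₂⟩ := h₂
    have hF : ∀ f, degF f ≤ c + 1 := by
      intro f
      obtain ⟨e⟩ := hcard₁ (degF f)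
      exact hb₁ 0 _ (Nat.ne_zero_of_lt (e ⟨f, rfl⟩).2)
    have hG : ∀ g, c < degG g := by
      intro g
      obtain ⟨e⟩ := hcard₂ (degG g)
      exact hb₂ 0 _ (Nat.ne_zero_of_lt (e ⟨g, rfl⟩).2)
    have hlift : ∀ g, ∃ y ∈ N, FreeHomog (Sum.elim degA degB) (degG g) y ∧
        freeSnd K σ A B y = d₂ (Finsupp.single g 1) := by
      intro g
      have hmem : d₂ (Finsupp.single g 1) ∈ N.map (freeSnd K σ A B) := hr₂ ▸ ⟨_, rfl⟩
      obtain ⟨y, hy, hyd⟩ := hmem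
      refine ⟨_, hN y hy (degG g), freeHomog_freeComp _ _ _, ?_⟩
      rw [freeSnd_freeComp, hyd]
      exact (hd₂ g).freeComp_eq
    choose t htN hthom htd using hlift
    set d := freeCoprod (freeInl K σ A B ∘ₗ d₁) t with hd
    have hdl : ∀ x, d (freeInl K σ F G x) = freeInl K σ A B (d₁ x) := fun x =>
      freeCoprod_freeInl _ _ x
    have hds : ∀ y, freeSnd K σ A B (d y) = d₂ (freeSnd K σ F G y) := by
      intro y
      have : freeSnd K σ A B ∘ₗ d = d₂ ∘ₗ freeSnd K σ F G := by
        ext v : 2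
        rcases v with f | g
        · have h1 := hdl (Finsupp.single f 1)
          have h2 := freeSnd_freeInl (K := K) (σ := σ) (B := G) (Finsupp.single f 1)
          rw [freeInl_single] at h1 h2
          simp [h1, h2, freeSnd_freeInl]
        · simp [hd, freeCoprod, htd, freeSnd_single_inr]
      exact LinearMap.congr_fun this y
    have hinl : ∀ x, freeInl K σ A B x ∈ N ↔ x ∈ LinearMap.range d₁ := by
      intro x
      rw [hr₁, Submodule.mem_comap]
    have hgr : GradedMap (Sum.elim degF degG) (Sum.elim degA degB) d := by
      refine gradedMap_freeCoprod (fun f => ?_) hthom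
      rintro (a | b) s hs
      · rw [LinearMap.comp_apply, freeInl_inl] at hs
        exact hd₁ f a s hs
      · rw [LinearMap.comp_apply, freeInl_inr] at hs
        exact absurd rfl hs
    have hdN : ∀ y, d y ∈ N := by
      intro y
      rw [hd, freeCoprod, Finsupp.linearCombination_apply]
      refine Submodule.sum_mem _ fun v _ => Submodule.smul_mem _ _ ?_
      rcases v with f | g
      · exact (hinl _).2 ⟨_, rfl⟩
      · exact htN g
    have hrange : LinearMap.range d = N := by
      refine le_antisymm ?_ fun y hy => ?_
      · rintro _ ⟨y, rfl⟩
        exact hdN y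
      · have hmem : freeSnd K σ A B y ∈ LinearMap.range d₂ := hr₂ ▸ ⟨y, hy, rfl⟩
        obtain ⟨g, hg⟩ := hmem
        set y' : F ⊕ G →₀ MvPolynomial σ K := Finsupp.mapDomain Sum.inr g with hy'
        have hsy' : freeSnd K σ F G y' = g := by
          ext1 b
          exact Finsupp.mapDomain_apply Sum.inr_injective g b
        obtain ⟨x, hx⟩ := exists_freeInl_eq (y := y - d y')
          (by rw [map_sub, hds, hsy', hg, sub_self])
        obtain ⟨z, rfl⟩ := (hinl x).1 (hx ▸ N.sub_mem hy (hdN y'))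
        refine ⟨freeInl K σ F G z + y', ?_⟩
        rw [map_add, hdl, hx, sub_add_cancel]
    refine ⟨fun y hy => ?_, F ⊕ G, Sum.elim degF degG, d, hgr, hrange, fun j => ?_, ?_⟩
    · rw [← hrange] at hy
      obtain ⟨y, rfl⟩ := hy
      refine constantCoeff_map_eq_zero_of_single ?_ y
      rintro (f | g) (a | b)
      · rw [← freeInl_single, hdl, freeInl_inl]
        exact hmin₁ _ (hr₁ ▸ ⟨_, rfl⟩) a
      · rw [← freeInl_single, hdl, freeInl_inr, map_zero]
      · by_contra hne
        have h1 := hgr _ _ 0 hne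
        have h2 := hG g
        have h3 := hA a
        simp only [Sum.elim_inl, Sum.elim_inr, map_zero] at h1
        omega
      · exact hmin₂ _ ⟨_, hdN _, rfl⟩ b
    · obtain ⟨e⟩ := hcard₁ j
      obtain ⟨e'⟩ := hcard₂ j
      exact nonempty_sum_fiber_equiv e e'
    · refine ih (c := c + 1) hgr.gradedSub_ker ?_ ?_ hF (fun i j h => ?_) (fun i j h => ?_)
      · convert hnext₁ using 1
        ext x
        rw [Submodule.mem_comap, LinearMap.mem_ker, LinearMap.mem_ker, hdl,
          map_eq_zero_iff _ freeInl_injective]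
      · convert hnext₂ using 1
        ext x
        constructor
        · rintro ⟨y, hy, rfl⟩
          have hy : d y = 0 := hy
          rw [LinearMap.mem_ker, ← hds, hy, map_zero]
        · intro hx
          set y' : F ⊕ G →₀ MvPolynomial σ K := Finsupp.mapDomain Sum.inr x with hy'
          have hsy' : freeSnd K σ F G y' = x := by
            ext1 b
            exact Finsupp.mapDomain_apply Sum.inr_injective x b
          obtain ⟨w, hw⟩ := exists_freeInl_eq (y := d y')
            (by rw [hds, hsy']; exact hx)
          obtain ⟨z, rfl⟩ := (hinl w).1 (hw ▸ hdN y')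
          refine ⟨y' - freeInl K σ F G z, ?_, ?_⟩
          · rw [SetLike.mem_coe, LinearMap.mem_ker, map_sub, hdl, hw, sub_self]
          · rw [map_sub, hsy', freeSnd_freeInl, sub_zero]
      · have := hb₁ (i + 1) j h
        omega
      · have := hb₂ (i + 1) j h
        omega

/-- The submodule of the free module of rank one given by an ideal. -/
noncomputable def idealSub (I : Ideal (MvPolynomial σ K)) :
    Submodule (MvPolynomial σ K) (Unit →₀ MvPolynomial σ K) :=
  Submodule.comap (Finsupp.lapply ()) I

theorem mem_idealSub {I : Ideal (MvPolynomial σ K)} {x : Unit →₀ MvPolynomial σ K} :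
    x ∈ idealSub I ↔ x () ∈ I := Iff.rfl

theorem eq_single_unit (x : Unit →₀ MvPolynomial σ K) : x = Finsupp.single () (x ()) := by
  ext1
  simp

/-- The submodule generated by `N` and a homogeneous element is resolved by a mapping cone. -/
theorem HasMinRes.sup_span_singleton {ℓ : ℕ} {A : Type} {degA : A → ℕ}
    {N : Submodule (MvPolynomial σ K) (A →₀ MvPolynomial σ K)} {b b' : ℕ → ℕ → ℕ} {e : ℕ}
    {z : A →₀ MvPolynomial σ K} (hz : FreeHomog degA e z)
    (hz0 : ∀ a, constantCoeff (z a) = 0) (hN : HasMinRes (ℓ + 1) degA N b)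
    {I : Ideal (MvPolynomial σ K)} (hI : ∀ p, p ∈ I ↔ p • z ∈ N)
    (hcolon : HasMinRes ℓ (fun _ : Unit => e) (idealSub I) b')
    (hb : ∀ i j, b i j ≠ 0 → j ≤ e + i) (hb' : ∀ i j, b' i j ≠ 0 → e + i < j) :
    HasMinRes (ℓ + 1) degA (N ⊔ Submodule.span _ {z})
      (fun i j => b i j + Nat.casesOn i (if j = e then 1 else 0) fun i => b' i j) := by
  obtain ⟨hmin, F, degF, d₁, hd₁, rfl, hcard, hnext⟩ := hN
  set d := freeCoprod d₁ (fun _ : Unit => z) with hd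
  have hdl : ∀ x, d (freeInl K σ F Unit x) = d₁ x := fun x => freeCoprod_freeInl _ _ x
  have hdr : ∀ p, d (Finsupp.single (Sum.inr ()) p) = p • z := by
    intro p
    simp [hd, freeCoprod]
  have hgr : GradedMap (Sum.elim degF fun _ : Unit => e) degA d :=
    gradedMap_freeCoprod hd₁ fun _ => hz
  have hdecomp : ∀ y : F ⊕ Unit →₀ MvPolynomial σ K, ∃ x,
      y = freeInl K σ F Unit x + Finsupp.single (Sum.inr ()) (y (Sum.inr ())) := by
    intro y
    obtain ⟨x, hx⟩ := exists_freeInl_eq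
      (y := y - Finsupp.single (Sum.inr ()) (y (Sum.inr ()))) (by
        rw [map_sub, freeSnd_single_inr]
        ext1
        simp [freeSnd_apply])
    exact ⟨x, by rw [hx, sub_add_cancel]⟩
  have hrange : LinearMap.range d = LinearMap.range d₁ ⊔ Submodule.span _ {z} := by
    refine le_antisymm ?_ (sup_le ?_ ?_)
    · rintro _ ⟨y, rfl⟩
      obtain ⟨x, hx⟩ := hdecomp y
      rw [hx, map_add, hdl, hdr]
      exact Submodule.add_mem_sup ⟨x, rfl⟩
        (Submodule.smul_mem _ _ (Submodule.mem_span_singleton_self z))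
    · rintro _ ⟨x, rfl⟩
      exact ⟨_, hdl x⟩
    · rw [Submodule.span_singleton_le_iff_mem]
      exact ⟨_, (hdr 1).trans (one_smul _ z)⟩
  refine ⟨fun y hy => ?_, F ⊕ Unit, Sum.elim degF fun _ => e, d, hgr, hrange, fun j => ?_, ?_⟩
  · obtain ⟨u, hu, v, hv, rfl⟩ := Submodule.mem_sup.1 hy
    obtain ⟨p, rfl⟩ := Submodule.mem_span_singleton.1 hv
    intro a
    rw [Finsupp.add_apply, map_add, hmin u hu, Finsupp.smul_apply, smul_eq_mul, map_mul, hz0,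
      mul_zero, add_zero]
  · obtain ⟨f⟩ := hcard j
    refine nonempty_sum_fiber_equiv f ?_
    by_cases hj : j = e
    · subst hj
      exact (Equiv.subtypeUnivEquiv fun _ => rfl).trans
        ((Equiv.ofUnique _ (Fin 1)).trans (finCongr (by simp)))
    · have : IsEmpty {v : Unit // e = j} := ⟨fun v => hj v.2.symm⟩
      exact (Equiv.equivOfIsEmpty _ (Fin 0)).trans (finCongr (by simp [hj]))
  · refine HasMinRes.horseshoe (c := e) ℓ hgr.gradedSub_ker ?_ ?_ (fun f => ?_)
      (fun i j h => ?_) hb'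
    · convert hnext using 1
      ext x
      rw [Submodule.mem_comap, LinearMap.mem_ker, LinearMap.mem_ker, hdl]
    · convert hcolon using 1
      ext x
      rw [mem_idealSub, hI]
      constructor
      · rintro ⟨y, hy, rfl⟩
        obtain ⟨x, hx⟩ := hdecomp y
        have hy : d y = 0 := hy
        rw [hx, map_add, hdl, hdr] at hy
        rw [freeSnd_apply, eq_neg_of_add_eq_zero_right hy]
        exact ⟨-x, map_neg _ _⟩
      · rintro ⟨y, hy⟩
        refine ⟨Finsupp.single (Sum.inr ()) (x ()) - freeInl K σ F Unit y, ?_, ?_⟩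
        · rw [SetLike.mem_coe, LinearMap.mem_ker, map_sub, hdl, hdr, hy, sub_self]
        · rw [map_sub, freeSnd_single_inr, freeSnd_freeInl, sub_zero, ← eq_single_unit]
    · obtain ⟨e'⟩ := hcard (degF f)
      exact hb 0 _ (Nat.ne_zero_of_lt (e' ⟨f, rfl⟩).2)
    · have := hb (i + 1) j h
      omega

theorem HasMinRes.bot (ℓ : ℕ) : ∀ {A : Type} {degA : A → ℕ},
    HasMinRes ℓ degA (⊥ : Submodule (MvPolynomial σ K) (A →₀ MvPolynomial σ K))
      fun _ _ => 0 := by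
  induction ℓ with
  | zero => intros; trivial
  | succ ℓ ih =>
    intro A degA
    refine ⟨fun y hy a => ?_, Empty, Empty.elim, 0, fun a => a.elim, LinearMap.range_zero,
      fun j => ⟨Equiv.equivOfIsEmpty _ _⟩, ?_⟩
    · rw [(Submodule.mem_bot _).1 hy, Finsupp.zero_apply, map_zero]
    · rw [LinearMap.ker_zero, Subsingleton.elim ⊤ ⊥]
      exact ih

/-- Adding a monomial generator to an ideal. -/
theorem HasMinRes.sup_monomial {ℓ c : ℕ} {I L : Ideal (MvPolynomial σ K)} {b b' : ℕ → ℕ → ℕ}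
    {s : σ →₀ ℕ} (hs : s ≠ 0) (hI : HasMinRes (ℓ + 1) (fun _ : Unit => c) (idealSub I) b)
    (hL : ∀ p, p ∈ L ↔ p * monomial s 1 ∈ I)
    (hcolon : HasMinRes ℓ (fun _ : Unit => c + s.degree) (idealSub L) b')
    (hb : ∀ i j, b i j ≠ 0 → j ≤ c + s.degree + i)
    (hb' : ∀ i j, b' i j ≠ 0 → c + s.degree + i < j) :
    HasMinRes (ℓ + 1) (fun _ : Unit => c) (idealSub (I ⊔ Ideal.span {monomial s 1}))
      (fun i j => b i j +
        Nat.casesOn i (if j = c + s.degree then 1 else 0) fun i => b' i j) := by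
  classical
  have h := HasMinRes.sup_span_singleton (z := Finsupp.single () (monomial s (1 : K)))
    (degA := fun _ : Unit => c) (e := c + s.degree) ?_ ?_ hI (I := L) (fun p => ?_) hcolon hb hb'
  · convert h using 1
    ext x
    rw [mem_idealSub, Submodule.mem_sup, Submodule.mem_sup]
    constructor
    · rintro ⟨u, hu, v, hv, huv⟩
      obtain ⟨p, rfl⟩ := Ideal.mem_span_singleton'.1 hv
      refine ⟨Finsupp.single () u, by simpa [mem_idealSub] using hu,
        p • Finsupp.single () (monomial s 1),
        Submodule.smul_mem _ _ (Submodule.mem_span_singleton_self _), ?_⟩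
      ext1
      simpa using huv
    · rintro ⟨u, hu, v, hv, rfl⟩
      obtain ⟨p, rfl⟩ := Submodule.mem_span_singleton.1 hv
      refine ⟨u (), hu, p * monomial s 1, Ideal.mul_mem_left _ _
        (Ideal.mem_span_singleton_self _), ?_⟩
      simp
  · rintro ⟨⟩ t ht
    rw [Finsupp.single_eq_same, coeff_monomial] at ht
    split_ifs at ht with hst
    · rw [hst]
    · exact absurd rfl ht
  · rintro ⟨⟩
    simp [constantCoeff_monomial, hs]
  · rw [hL, mem_idealSub]
    simp

/-- The Koszul resolution of an ideal generated by variables. -/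
theorem hasMinRes_span_X (V : Finset σ) : ∀ ℓ c : ℕ,
    HasMinRes ℓ (fun _ : Unit => c) (idealSub (Ideal.span (X '' (V : Set σ)) :
      Ideal (MvPolynomial σ K)))
      fun i j => if j = c + i + 1 then V.card.choose (i + 1) else 0 := by
  classical
  induction V using Finset.induction_on with
  | empty =>
    intro ℓ c
    have h0 : idealSub (Ideal.span (X '' ((∅ : Finset σ) : Set σ)) :
        Ideal (MvPolynomial σ K)) = ⊥ := by
      rw [eq_bot_iff]
      intro x hx
      rw [mem_idealSub] at hx
      rw [Submodule.mem_bot, eq_single_unit x]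
      simpa using hx
    rw [h0]
    convert HasMinRes.bot ℓ
    simp
  | insert y V hy ih =>
    intro ℓ c
    cases ℓ with
    | zero => trivial
    | succ ℓ =>
      have hX : (X y : MvPolynomial σ K) = monomial (Finsupp.single y 1) 1 := rfl
      have h := HasMinRes.sup_monomial (s := Finsupp.single y 1) (by simp) (ih (ℓ + 1) c)
        (L := Ideal.span (X '' (V : Set σ))) (fun p => ?_) (ih ℓ _) (fun i j h => ?_)
        (fun i j h => ?_)
      · convert h using 1
        · rw [Finset.coe_insert, Set.image_insert_eq, Ideal.span_insert, sup_comm, hX]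
        · funext i j
          rw [Finset.card_insert_of_notMem hy, Nat.choose_succ_succ]
          rcases i with - | i
          · simp only [Finsupp.degree_single]
            split_ifs <;> simp_all
            all_goals omega
          · simp only [Finsupp.degree_single]
            split_ifs <;> simp_all
            all_goals omega
      · rw [mem_ideal_span_X_image, mem_ideal_span_X_image, ← hX]
        simp only [support_mul_X, Finset.mem_map, addRightEmbedding_apply,
          forall_exists_index, and_imp, forall_apply_eq_imp_iff₂]
        refine forall₂_congr fun m _ => exists_congr fun i => and_congr_right fun hi => ?_
        have hiy : i ≠ y := fun h => hy (h ▸ hi)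
        rw [Finsupp.add_apply, Finsupp.single_eq_of_ne hiy, add_zero]
      · have : j = c + i + 1 := by
          by_contra hne
          exact h (if_neg hne)
        rw [Finsupp.degree_single]
        omega
      · have : j = c + (Finsupp.single y 1).degree + i + 1 := by
          by_contra hne
          exact h (if_neg hne)
        omega

/-- The exponent vector of a squarefree monomial. -/
noncomputable def indVec (C : Finset σ) : σ →₀ ℕ := ∑ e ∈ C, Finsupp.single e 1

theorem indVec_apply [DecidableEq σ] (C : Finset σ) (e : σ) :
    indVec C e = if e ∈ C then 1 else 0 := by
  simp [indVec, Finsupp.finsetSum_apply, Finsupp.single_apply]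

theorem degree_indVec (C : Finset σ) : (indVec C).degree = C.card := by
  simp [indVec, map_sum]

theorem prod_X_eq_monomial (C : Finset σ) :
    (∏ e ∈ C, X e : MvPolynomial σ K) = monomial (indVec C) 1 := by
  rw [indVec, monomial_sum_one]
  rfl

theorem forall_mem_support_mul_monomial_one (p : MvPolynomial σ K) (s : σ →₀ ℕ)
    (P : (σ →₀ ℕ) → Prop) :
    (∀ m ∈ (p * monomial s 1).support, P m) ↔ ∀ m ∈ p.support, P (m + s) := by
  classical
  simp only [mem_support_iff]
  refine ⟨fun h m hm => h _ (by rwa [coeff_mul_monomial, mul_one]), fun h m hm => ?_⟩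
  rw [coeff_mul_monomial'] at hm
  split_ifs at hm with hsm
  · rw [mul_one] at hm
    simpa [tsub_add_cancel_of_le hsm] using h _ hm
  · exact absurd rfl hm

/-- A squarefree monomial ideal whose generators carry a compatible partial order has linear
quotients: the colon ideal of the generator `t` is generated by the variables in `anc t`. -/
theorem hasMinRes_of_linearQuotients {τ : Type} [PartialOrder τ] {supp anc : τ → Finset σ}
    (hne : ∀ t, (supp t).Nonempty) (hmono : ∀ u t, u ≤ t → (supp u).card ≤ (supp t).card)
    (hdisj : ∀ t, ∀ y ∈ anc t, y ∉ supp t)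
    (hanc : ∀ t, ∀ y ∈ anc t, ∃ u < t, ∀ z ∈ supp u, z = y ∨ z ∈ supp t)
    (hsupp : ∀ t u, ¬ t ≤ u → ∃ y ∈ anc t, y ∈ supp u) (n : ℕ) :
    ∀ T : Finset τ, T.card = n → (∀ t ∈ T, ∀ u < t, u ∈ T) → ∀ ℓ,
      HasMinRes ℓ (fun _ : Unit => 0)
        (idealSub (Ideal.span ((fun s => monomial s (1 : K)) ''
          ((fun t => indVec (supp t)) '' (T : Set τ)))))
        fun i j => ∑ t ∈ T, if j = (supp t).card + i then (anc t).card.choose i else 0 := by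
  classical
  induction n with
  | zero =>
    intro T hT _ ℓ
    rw [Finset.card_eq_zero] at hT
    subst hT
    have h0 : idealSub (Ideal.span ((fun s => monomial s (1 : K)) ''
        ((fun t => indVec (supp t)) '' ((∅ : Finset τ) : Set τ)))) = ⊥ := by
      rw [eq_bot_iff]
      intro x hx
      rw [mem_idealSub] at hx
      rw [Submodule.mem_bot, eq_single_unit x]
      simpa using hx
    rw [h0]
    exact HasMinRes.bot ℓ
  | succ n ih =>
    intro T hT hlow ℓ
    cases ℓ with
    | zero => trivial
    | succ ℓ =>
    have hTne : T.Nonempty := Finset.card_pos.1 (by omega)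
    obtain ⟨t₀, ht₀, ht₀max⟩ := T.exists_max_image (fun t => (supp t).card) hTne
    obtain ⟨t, htmem, htmax⟩ :=
      (T.filter fun t => (supp t).card = (supp t₀).card).exists_maximal
        ⟨t₀, by simp [ht₀]⟩
    rw [Finset.mem_filter] at htmem
    obtain ⟨ht, htc⟩ := htmem
    have hcard : ∀ u ∈ T, (supp u).card ≤ (supp t).card := fun u hu => htc ▸ ht₀max u hu
    have hmax : ∀ u ∈ T, t ≤ u → u = t := by
      intro u hu htu
      refine le_antisymm (htmax (Finset.mem_filter.2 ⟨hu, ?_⟩) htu) htu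
      exact (le_antisymm (hcard u hu) (hmono t u htu)).trans htc
    have hTe : ∀ u ∈ T.erase t, ∃ y ∈ anc t, y ∈ supp u := by
      intro u hu
      rw [Finset.mem_erase] at hu
      exact hsupp t u fun h => hu.1 (hmax u hu.2 h)
    have ih' := ih (T.erase t) (by rw [Finset.card_erase_of_mem ht]; omega) fun u hu v hv => by
      rw [Finset.mem_erase] at hu ⊢
      refine ⟨fun h => ?_, hlow u hu.2 v hv⟩
      subst h
      exact hu.1 (hmax u hu.2 hv.le)
    have hsne : indVec (supp t) ≠ 0 := by
      intro h
      obtain ⟨y, hy⟩ := hne t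
      have := DFunLike.congr_fun h y
      simp [indVec_apply, hy] at this
    have h := HasMinRes.sup_monomial hsne (ih' (ℓ + 1))
      (L := Ideal.span (X '' (anc t : Set σ))) (fun p => ?_)
      (hasMinRes_span_X (anc t) ℓ _) (fun i j h => ?_) (fun i j h => ?_)
    · convert h using 1
      · conv_lhs => rw [← Finset.insert_erase ht, Finset.coe_insert, Set.image_insert_eq,
          Set.image_insert_eq, Ideal.span_insert, sup_comm]
      · funext i j
        rw [← Finset.add_sum_erase T _ ht, add_comm]
        congr 1
        rw [degree_indVec]
        rcases i with - | i
        · simp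
        · simp only [zero_add]
          congr 1
    · rw [mem_ideal_span_X_image, mem_ideal_span_monomial_image,
        forall_mem_support_mul_monomial_one]
      simp only [Set.exists_mem_image]
      refine forall₂_congr fun m _ => ⟨?_, ?_⟩
      · rintro ⟨y, hy, hmy⟩
        obtain ⟨u, hut, hu⟩ := hanc t y hy
        refine ⟨u, by simpa using ⟨hlow t ht u hut, hut.ne⟩, fun z => ?_⟩
        rw [Finsupp.add_apply, indVec_apply, indVec_apply]
        split_ifs with h1 h2
        · omega
        · rcases hu z h1 with rfl | h3
          · omega
          · exact absurd h3 h2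
        all_goals omega
      · rintro ⟨u, hu, hle⟩
        obtain ⟨y, hy, hyu⟩ := hTe u hu
        refine ⟨y, hy, ?_⟩
        have := hle y
        rw [Finsupp.add_apply, indVec_apply, indVec_apply, if_pos hyu,
          if_neg (hdisj t y hy)] at this
        omega
    · rw [degree_indVec]
      obtain ⟨u, hu, hne0⟩ := Finset.exists_ne_zero_of_sum_ne_zero h
      have h1 := hcard u (Finset.mem_of_mem_erase hu)
      have h2 : j = (supp u).card + i := by
        by_contra hj
        exact hne0 (if_neg hj)
      omega
    · have : j = 0 + (indVec (supp t)).degree + i + 1 := by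
        by_contra hj
        exact h (if_neg hj)
      omega

end GradedFree

section CutPosets

/-- The combinatorial conditions satisfied by the supports of a family of squarefree monomials
with linear quotients, where `anc t` is the set of variables generating the colon ideal of `t`,
which has `r` elements less than the support of `t`. -/
structure CutPoset (σ : Type) {τ : Type} [PartialOrder τ] (r : ℕ) (supp anc : τ → Finset σ) :
    Prop where
  card_supp : ∀ t, (supp t).card = (anc t).card + r
  mono : ∀ u t, u ≤ t → (supp u).card ≤ (supp t).card
  disjoint : ∀ t, ∀ y ∈ anc t, y ∉ supp t
  exists_lt : ∀ t, ∀ y ∈ anc t, ∃ u < t, ∀ z ∈ supp u, z = y ∨ z ∈ supp t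
  exists_mem : ∀ t u, ¬ t ≤ u → ∃ y ∈ anc t, y ∈ supp u

/-- The supports after adding a new variable to an ideal. -/
def botSupp {σ τ : Type} (supp : τ → Finset σ) : WithBot τ → Finset (Option σ)
  | none => {none}
  | some t => (supp t).map .some

/-- The colon variables after adding a new variable to an ideal. -/
def botAnc {σ τ : Type} (anc : τ → Finset σ) : WithBot τ → Finset (Option σ)
  | none => ∅
  | some t => Finset.insertNone (anc t)

theorem CutPoset.withBot {σ τ : Type} [PartialOrder τ] {r : ℕ} {supp anc : τ → Finset σ}
    (h : CutPoset σ (r + 1) supp anc) (hr : r = 1) :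
    CutPoset (Option σ) r (botSupp supp) (botAnc anc) where
  card_supp w := by
    subst hr
    cases w with
    | bot => rfl
    | coe t =>
      change ((supp t).map .some).card = (Finset.insertNone (anc t)).card + 1
      rw [Finset.card_map, Finset.card_insertNone, h.card_supp]
  mono u w huw := by
    subst hr
    cases w with
    | bot =>
      rw [le_bot_iff.1 huw]
    | coe t =>
      change _ ≤ ((supp t).map .some).card
      rw [Finset.card_map]
      cases u with
      | bot =>
        change 1 ≤ _
        rw [h.card_supp]
        omega
      | coe u =>
        change ((supp u).map .some).card ≤ _
        rw [Finset.card_map]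
        exact h.mono u t (WithBot.coe_le_coe.1 huw)
  disjoint w y hy := by
    cases w with
    | bot => exact absurd hy (Finset.notMem_empty y)
    | coe t =>
      change y ∈ Finset.insertNone (anc t) at hy
      change y ∉ (supp t).map .some
      cases y with
      | none => simp
      | some y =>
        rw [Finset.some_mem_insertNone] at hy
        simpa using h.disjoint t y hy
  exists_lt w y hy := by
    cases w with
    | bot => exact absurd hy (Finset.notMem_empty y)
    | coe t =>
      change y ∈ Finset.insertNone (anc t) at hy
      cases y with
      | none => exact ⟨⊥, WithBot.bot_lt_coe t, fun z hz => Or.inl (Finset.mem_singleton.1 hz)⟩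
      | some y =>
        rw [Finset.some_mem_insertNone] at hy
        obtain ⟨u, hut, hu⟩ := h.exists_lt t y hy
        refine ⟨u, WithBot.coe_lt_coe.2 hut, fun z hz => ?_⟩
        obtain ⟨z, hzu, rfl⟩ := Finset.mem_map.1 hz
        rcases hu z hzu with rfl | hz
        · exact Or.inl rfl
        · exact Or.inr (Finset.mem_map_of_mem _ hz)
  exists_mem w u hwu := by
    cases w with
    | bot => exact absurd bot_le hwu
    | coe t =>
      cases u with
      | bot => exact ⟨none, Finset.none_mem_insertNone, Finset.mem_singleton_self _⟩
      | coe u =>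
        obtain ⟨y, hy, hyu⟩ := h.exists_mem t u fun h => hwu (WithBot.coe_le_coe.2 h)
        exact ⟨some y, Finset.some_mem_insertNone.2 hy, Finset.mem_map_of_mem _ hyu⟩

theorem CutPoset.prod {σ ρ τ : Type} [PartialOrder τ] {r : ℕ} {supp anc : τ → Finset σ}
    (h : CutPoset σ r supp anc) {f g : σ ↪ ρ} (hfg : ∀ x y, f x ≠ g y) :
    CutPoset ρ (τ := τ × τ) (r + r)
      (fun t => ((supp t.1).map f).disjUnion ((supp t.2).map g) (by
        simp only [Finset.disjoint_left, Finset.mem_map]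
        rintro _ ⟨x, _, rfl⟩ ⟨y, _, hy⟩
        exact hfg x y hy.symm))
      (fun t => ((anc t.1).map f).disjUnion ((anc t.2).map g) (by
        simp only [Finset.disjoint_left, Finset.mem_map]
        rintro _ ⟨x, _, rfl⟩ ⟨y, _, hy⟩
        exact hfg x y hy.symm)) where
  card_supp t := by
    simp only [Finset.card_disjUnion, Finset.card_map, h.card_supp]
    omega
  mono u t hut := by
    simp only [Finset.card_disjUnion, Finset.card_map]
    exact add_le_add (h.mono _ _ hut.1) (h.mono _ _ hut.2)
  disjoint t y hy := by
    simp only [Finset.mem_disjUnion, Finset.mem_map] at hy ⊢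
    rintro (⟨z, hz, rfl⟩ | ⟨z, hz, rfl⟩) <;> rcases hy with ⟨x, hx, hxz⟩ | ⟨x, hx, hxz⟩
    · exact h.disjoint _ _ hx (f.injective hxz ▸ hz)
    · exact hfg _ _ hxz.symm
    · exact hfg _ _ hxz
    · exact h.disjoint _ _ hx (g.injective hxz ▸ hz)
  exists_lt := by
    rintro ⟨t₁, t₂⟩ y hy
    simp only [Finset.mem_disjUnion, Finset.mem_map] at hy ⊢
    rcases hy with ⟨x, hx, rfl⟩ | ⟨x, hx, rfl⟩
    · obtain ⟨u, hut, hu⟩ := h.exists_lt _ x hx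
      refine ⟨(u, t₂), Prod.mk_lt_mk_iff_left.2 hut, ?_⟩
      rintro _ (⟨z, hz, rfl⟩ | ⟨z, hz, rfl⟩)
      · rcases hu z hz with rfl | hz
        · exact Or.inl rfl
        · exact Or.inr (Or.inl ⟨z, hz, rfl⟩)
      · exact Or.inr (Or.inr ⟨z, hz, rfl⟩)
    · obtain ⟨u, hut, hu⟩ := h.exists_lt _ x hx
      refine ⟨(t₁, u), Prod.mk_lt_mk_iff_right.2 hut, ?_⟩
      rintro _ (⟨z, hz, rfl⟩ | ⟨z, hz, rfl⟩)
      · exact Or.inr (Or.inl ⟨z, hz, rfl⟩)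
      · rcases hu z hz with rfl | hz
        · exact Or.inl rfl
        · exact Or.inr (Or.inr ⟨z, hz, rfl⟩)
  exists_mem t u htu := by
    rw [Prod.le_def, not_and_or] at htu
    simp only [Finset.mem_disjUnion, Finset.mem_map]
    rcases htu with h' | h'
    · obtain ⟨y, hy, hyu⟩ := h.exists_mem _ _ h'
      exact ⟨f y, Or.inl ⟨y, hy, rfl⟩, Or.inl ⟨y, hyu, rfl⟩⟩
    · obtain ⟨y, hy, hyu⟩ := h.exists_mem _ _ h'
      exact ⟨g y, Or.inr ⟨y, hy, rfl⟩, Or.inr ⟨y, hyu, rfl⟩⟩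

end CutPosets

section Trees

/-- The edges in the branch `a` of a tree: the edge at the root and the edges of the subtree. -/
def branchEdge {k n : ℕ} (a : Fin k) : Option (TreeEdge k n) → TreeEdge k (n + 1)
  | none => ⟨0, fun _ => a⟩
  | some ⟨i, p⟩ => ⟨i.succ, Fin.cons a p⟩

/-- The part of an edge which lies in the subtree below the first edge. -/
def edgeTail {k n : ℕ} : TreeEdge k (n + 1) → Option (TreeEdge k n)
  | ⟨⟨0, _⟩, _⟩ => none
  | ⟨⟨i + 1, h⟩, p⟩ => some ⟨⟨i, Nat.lt_of_succ_lt_succ h⟩, fun t => p t.succ⟩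

theorem edgeTail_branchEdge {k n : ℕ} (a : Fin k) (x : Option (TreeEdge k n)) :
    edgeTail (branchEdge a x) = x := by
  rcases x with - | ⟨i, p⟩ <;> rfl

theorem branchEdge_zero {k n : ℕ} (a : Fin k) (x : Option (TreeEdge k n)) :
    (branchEdge a x).2 0 = a := by
  rcases x with - | ⟨i, p⟩ <;> rfl

/-- The inclusion of a branch into the tree. -/
def branchEmbedding {k n : ℕ} (a : Fin k) : Option (TreeEdge k n) ↪ TreeEdge k (n + 1) :=
  ⟨branchEdge a, Function.LeftInverse.injective (edgeTail_branchEdge a)⟩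

theorem branchEmbedding_ne {k n : ℕ} {a b : Fin k} (hab : a ≠ b)
    (x y : Option (TreeEdge k n)) : branchEmbedding a x ≠ branchEmbedding b y := by
  intro h
  have h' : branchEdge a x = branchEdge b y := h
  exact hab (by rw [← branchEdge_zero a x, h', branchEdge_zero])

theorem pathEdge_cons_zero {k n : ℕ} (a : Fin k) (ℓ : TreeLeaf k n) :
    pathEdge (Fin.cons a ℓ : TreeLeaf k (n + 1)) 0 = branchEmbedding a none := by
  refine Sigma.ext rfl (heq_of_eq (funext fun t => ?_))
  obtain rfl : t = 0 := Subsingleton.elim (α := Fin 1) _ _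
  rfl

theorem pathEdge_cons_succ {k n : ℕ} (a : Fin k) (ℓ : TreeLeaf k n) (i : Fin n) :
    pathEdge (Fin.cons a ℓ : TreeLeaf k (n + 1)) i.succ =
      branchEmbedding a (some (pathEdge ℓ i)) := by
  refine Sigma.ext rfl (heq_of_eq (funext fun t => ?_))
  refine Fin.cases ?_ (fun t => ?_) t <;> rfl

open Classical in
theorem treeIsCut_succ {k n : ℕ} (C : Finset (TreeEdge k (n + 1))) :
    TreeIsCut C ↔ ∀ a, branchEmbedding a none ∈ C ∨
      TreeIsCut (Finset.univ.filter fun e => branchEmbedding a (some e) ∈ C) := by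
  constructor
  · intro h a
    by_contra! hC
    refine hC.2 fun ℓ => ?_
    obtain ⟨i, hi⟩ := h (Fin.cons a ℓ)
    induction i using Fin.cases with
    | zero => exact absurd (pathEdge_cons_zero a ℓ ▸ hi) hC.1
    | succ i => exact ⟨i, by simpa [← pathEdge_cons_succ] using hi⟩
  · intro h ℓ
    rw [← Fin.cons_self_tail ℓ]
    rcases h (ℓ 0) with h | h
    · exact ⟨0, by rwa [pathEdge_cons_zero]⟩
    · obtain ⟨i, hi⟩ := h (Fin.tail ℓ)
      exact ⟨i.succ, by rw [pathEdge_cons_succ]; exact (Finset.mem_filter.1 hi).2⟩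

theorem exists_cutPoset (n : ℕ) : ∃ (τ : Type) (_ : PartialOrder τ) (_ : Fintype τ)
    (supp anc : τ → Finset (TreeEdge 2 n)), CutPoset (TreeEdge 2 n) 2 supp anc ∧
      (∀ C, TreeIsCut C ↔ ∃ t, supp t ⊆ C) ∧
      ∑ t, (Polynomial.X : Polynomial ℕ) ^ (supp t).card + Polynomial.X =
        mandelbrot (n + 1) := by
  classical
  induction n with
  | zero =>
    refine ⟨Empty, inferInstance, inferInstance, Empty.elim, Empty.elim,
      ⟨fun t => t.elim, fun t => t.elim, fun t => t.elim, fun t => t.elim, fun t => t.elim⟩,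
      fun C => ⟨fun h => ?_, fun h => h.choose.elim⟩, ?_⟩
    · exact (h Fin.elim0).choose.elim0
    · simp [mandelbrot]
  | succ n ih =>
    obtain ⟨τ, _, _, supp, anc, h, hcut, hsum⟩ := ih
    have hP := (h.withBot rfl).prod (branchEmbedding_ne (k := 2) (n := n) zero_ne_one)
    refine ⟨WithBot τ × WithBot τ, inferInstance, inferInstance, _, _, hP, fun C => ?_, ?_⟩
    · have hw : ∀ a, (∃ w, (botSupp supp w).map (branchEmbedding a) ⊆ C) ↔
          (branchEmbedding a none ∈ C ∨
            TreeIsCut (Finset.univ.filter fun e => branchEmbedding a (some e) ∈ C)) := by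
        intro a
        rw [hcut]
        constructor
        · rintro ⟨w, hw⟩
          cases w with
          | bot => exact Or.inl (hw (Finset.mem_map_of_mem _ (Finset.mem_singleton_self _)))
          | coe t =>
            refine Or.inr ⟨t, fun e he => Finset.mem_filter.2 ⟨Finset.mem_univ _, hw ?_⟩⟩
            exact Finset.mem_map_of_mem _ (Finset.mem_map_of_mem _ he)
        · rintro (hw | ⟨t, ht⟩)
          · refine ⟨⊥, fun e he => ?_⟩
            obtain ⟨x, hx, rfl⟩ := Finset.mem_map.1 he
            rwa [Finset.mem_singleton.1 hx]
          · refine ⟨t, fun e he => ?_⟩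
            obtain ⟨x, hx, rfl⟩ := Finset.mem_map.1 he
            obtain ⟨y, hy, rfl⟩ := Finset.mem_map.1 hx
            exact (Finset.mem_filter.1 (ht hy)).2
      rw [treeIsCut_succ, Fin.forall_fin_two, ← hw, ← hw]
      simp only [Finset.disjUnion_eq_union, Finset.union_subset_iff, Prod.exists]
      exact ⟨fun ⟨⟨u, hu⟩, v, hv⟩ => ⟨u, v, hu, hv⟩, fun ⟨u, v, hu, hv⟩ => ⟨⟨u, hu⟩, v, hv⟩⟩
    · have hbot : ∑ w, (Polynomial.X : Polynomial ℕ) ^ (botSupp supp w).card =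
          mandelbrot (n + 1) := by
        rw [← hsum, add_comm]
        refine (Fintype.sum_option (α := τ) _).trans ?_
        congr 1
        · change Polynomial.X ^ 1 = _
          rw [pow_one]
        · refine Finset.sum_congr rfl fun t _ => ?_
          change Polynomial.X ^ ((supp t).map .some).card = _
          rw [Finset.card_map]
      rw [mandelbrot, ← hbot, sq, Finset.sum_mul_sum, Fintype.sum_prod_type]
      simp only [Finset.card_disjUnion, Finset.card_map, pow_add]

end Trees

section Betti

theorem cutIdeal_eq_span (K : Type) [Field K] {k n : ℕ} {τ : Type}
    {supp : τ → Finset (TreeEdge k n)} (hcut : ∀ C, TreeIsCut C ↔ ∃ t, supp t ⊆ C) :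
    cutIdeal K k n = Ideal.span ((fun s => monomial s (1 : K)) ''
      ((fun t => indVec (supp t)) '' Set.univ)) := by
  classical
  refine le_antisymm (Ideal.span_le.2 ?_) (Ideal.span_le.2 ?_)
  · rintro _ ⟨C, hC, rfl⟩
    obtain ⟨t, ht⟩ := (hcut C).1 hC.1
    rw [← Finset.prod_sdiff ht]
    refine Ideal.mul_mem_left _ _ (Ideal.subset_span ⟨_, ⟨t, trivial, rfl⟩, ?_⟩)
    exact (prod_X_eq_monomial _).symm
  · rintro _ ⟨_, ⟨t, -, rfl⟩, rfl⟩
    obtain ⟨C, hCt, hC⟩ := exists_minimal_le_of_wellFoundedLT (fun C => TreeIsCut C) (supp t)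
      ((hcut _).2 ⟨t, subset_rfl⟩)
    change monomial (indVec (supp t)) 1 ∈ _
    rw [← prod_X_eq_monomial, ← Finset.prod_sdiff hCt]
    refine Ideal.mul_mem_left _ _ (Ideal.subset_span ⟨C, ⟨hC.1, fun C' hC' h => ?_⟩, rfl⟩)
    exact le_antisymm hC' (hC.2 h hC')

/-- The linear quotients resolution of the cut ideal of the binary tree. -/
theorem hasMinRes_cutIdeal (K : Type) [Field K] (n ℓ : ℕ) :
    ∃ b : ℕ → ℕ → ℕ, HasMinRes ℓ (fun _ : Unit => 0) (idealSub (cutIdeal K 2 n)) b ∧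
      ∀ i j, 1 ≤ j → b i (i + 1 + j) =
        (mandelbrot (n + 1)).coeff (j + 1) * Nat.choose (j - 1) i := by
  obtain ⟨τ, _, _, supp, anc, h, hcut, hsum⟩ := exists_cutPoset n
  refine ⟨fun i j => ∑ t, if j = (supp t).card + i then (anc t).card.choose i else 0, ?_,
    fun i j hj => ?_⟩
  · have := hasMinRes_of_linearQuotients (K := K) (fun t => ?_) h.mono h.disjoint h.exists_lt
      h.exists_mem _ Finset.univ rfl (fun _ _ _ _ => Finset.mem_univ _) ℓ
    · rwa [Finset.coe_univ, ← cutIdeal_eq_span K hcut] at this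
    · rw [← Finset.card_pos, h.card_supp]
      omega
  · rw [← hsum, Polynomial.coeff_add, Polynomial.coeff_X, if_neg (by omega), add_zero,
      Polynomial.finsetSum_coeff, Finset.sum_mul]
    refine Finset.sum_congr rfl fun t _ => ?_
    have := h.card_supp t
    rw [Polynomial.coeff_X_pow]
    by_cases hjt : j + 1 = (supp t).card
    · rw [if_pos (by omega), if_pos hjt, one_mul]
      congr 1
      omega
    · rw [if_neg (by omega), if_neg hjt, zero_mul]

variable {K : Type} [Field K] {σ : Type} {I : Ideal (MvPolynomial σ K)} {b : ℕ → ℕ → ℕ}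

theorem MinGradedFreeRes.gradedMap (hb : MinGradedFreeRes K σ I b) (i : ℕ) :
    GradedMap (fun v : Σ j : ℕ, Fin (b (i + 1) j) => v.1) (fun w : Σ j : ℕ, Fin (b i j) => w.1)
      (hb.d i) := by
  intro v w s hs
  obtain ⟨hle, hhom⟩ := hb.graded i v w fun h0 => hs (by rw [h0, coeff_zero])
  have := hhom hs
  have hdeg := DFunLike.congr_fun (Finsupp.degree_eq_weight_one (R := ℕ)) s
  change w.1 + s.degree = v.1
  rw [hdeg.trans this]
  omega

theorem MinGradedFreeRes.hasMinRes (hb : MinGradedFreeRes K σ I b) (ℓ : ℕ) : ∀ i,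
    HasMinRes ℓ (fun v : Σ j : ℕ, Fin (b i j) => v.1) (LinearMap.range (hb.d i))
      fun p => b (i + 1 + p) := by
  induction ℓ with
  | zero => intros; trivial
  | succ ℓ ih =>
    intro i
    refine ⟨?_, _, fun v => v.1, hb.d i, hb.gradedMap i, rfl, fun j => ⟨?_⟩, ?_⟩
    · rintro _ ⟨y, rfl⟩ a
      exact constantCoeff_map_eq_zero_of_single (hb.minimal i) y a
    · exact Equiv.sigmaSubtype j
    · rw [hb.exact i]
      convert ih (i + 1) using 3
      omega

/-- The graded Betti numbers of any minimal graded free resolution can be read off from a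
minimal resolution of the ideal. -/
theorem MinGradedFreeRes.betti_eq (hb : MinGradedFreeRes K σ I b) {i : ℕ} {b' : ℕ → ℕ → ℕ}
    (h' : HasMinRes (i + 2) (fun _ : Unit => 0) (idealSub I) b') (j : ℕ) :
    b (i + 1) j = b' i j := by
  have h := hb.hasMinRes (i + 2) 0
  obtain ⟨_, B, degB, d, hd, hdI, -⟩ := id h'
  have hgI : GradedSub (fun _ : Unit => 0) (idealSub I) := hdI ▸ hd.gradedSub_range
  choose g hg haug using hb.graded_aug
  set α : ((Σ j : ℕ, Fin (b 0 j)) →₀ MvPolynomial σ K) →ₗ[MvPolynomial σ K]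
    (Unit →₀ MvPolynomial σ K) :=
    Finsupp.linearCombination _ fun v => Finsupp.single () (g v) with hα
  have hαgr : GradedMap (fun v : Σ j : ℕ, Fin (b 0 j) => v.1) (fun _ : Unit => 0) α := by
    rintro v ⟨⟩ s hs
    have := hg v (by simpa [hα] using hs)
    have hdeg := DFunLike.congr_fun (Finsupp.degree_eq_weight_one (R := ℕ)) s
    simp only [zero_add]
    exact hdeg.trans this
  have hαaug : ∀ y, hb.aug y = Ideal.Quotient.mk I (α y ()) := by
    intro y
    have : hb.aug = I.mkQ ∘ₗ Finsupp.lapply () ∘ₗ α := by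
      ext v
      simp [hα, haug]
    rw [this]
    rfl
  have hmem : ∀ y, y ∈ LinearMap.range (hb.d 0) ↔ α y ∈ idealSub I := by
    intro y
    rw [← hb.exact_zero, LinearMap.mem_ker, hαaug, Ideal.Quotient.eq_zero_iff_mem, mem_idealSub]
  obtain ⟨y₁, hy₁⟩ := hb.aug_surjective 1
  set y₀ := freeComp (fun v : Σ j : ℕ, Fin (b 0 j) => v.1) 0 y₁ with hy₀
  have hone : α y₀ - Finsupp.single () 1 ∈ idealSub I := by
    have h1 : α y₁ - Finsupp.single () 1 ∈ idealSub I := by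
      rw [mem_idealSub, Finsupp.sub_apply, Finsupp.single_eq_same, ← Ideal.Quotient.eq_zero_iff_mem,
        map_sub, ← hαaug, hy₁, map_one, sub_self]
    have h2 := hgI _ h1 0
    rw [map_sub, ← hαgr.map_freeComp,
      (freeHomog_single_one (fun _ : Unit => 0) ()).freeComp_eq] at h2
    exact h2
  set β : (Unit →₀ MvPolynomial σ K) →ₗ[MvPolynomial σ K]
    ((Σ j : ℕ, Fin (b 0 j)) →₀ MvPolynomial σ K) :=
    Finsupp.linearCombination _ fun _ => y₀ with hβ
  have hβx : ∀ x, β x = x () • y₀ := by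
    intro x
    conv_lhs => rw [eq_single_unit x]
    rw [hβ, Finsupp.linearCombination_single]
  have hβgr : GradedMap (fun _ : Unit => 0) (fun v : Σ j : ℕ, Fin (b 0 j) => v.1) β := by
    rintro ⟨⟩
    rw [hβx, Finsupp.single_eq_same, one_smul]
    exact freeHomog_freeComp _ _ _
  have hαβ : ∀ x, α (β x) - x ∈ idealSub I := by
    intro x
    have : α (β x) - x = x () • (α y₀ - Finsupp.single () 1) := by
      conv_lhs => rw [hβx, map_smul]
      conv_lhs => rw [eq_single_unit x]
      rw [smul_sub, Finsupp.smul_single, smul_eq_mul, mul_one, Finsupp.single_eq_same]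
    rw [this]
    exact Submodule.smul_mem _ _ hone
  have hαI : ∀ y ∈ LinearMap.range (hb.d 0), α y ∈ idealSub I := fun y hy => (hmem y).1 hy
  have hβI : ∀ x ∈ idealSub I, β x ∈ LinearMap.range (hb.d 0) := by
    intro x hx
    rw [hmem]
    simpa using Submodule.add_mem _ (hαβ x) hx
  have hbi : b (i + 1) j = b (0 + 1 + i) j := by
    congr 1
    omega
  rw [hbi]
  refine le_antisymm (HasMinRes.betti_le i h h' α β 0 hαgr hβgr hαI hβI (fun _ _ => rfl)
    (fun y => ?_) j) (HasMinRes.betti_le i h' h β α 0 hβgr hαgr hβI hαI (fun _ _ => rfl)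
    (fun x => ?_) j)
  · rw [LinearMap.zero_apply, sub_zero, hmem, map_sub]
    exact hαβ (α y)
  · rw [LinearMap.zero_apply, sub_zero]
    exact hαβ x

end Betti

/-- The graded Betti numbers of the cut ideal of the binary tree of depth `n`
satisfy `β_{i,i+j}(J_{2,n}) = M_{n+1,j+1} ⬝ binomial (j-1) (i-1)` (for `i,j ≥ 1`),
where `M_{n,j}` is the coefficient of `q^j` in the Mandelbrot polynomial `z_n`. -/
theorem cutIdeal_betti_eq_mandelbrot (K : Type) [Field K] (n : ℕ) (hn : 1 ≤ n)
    (b : ℕ → ℕ → ℕ)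
    (hb : MinGradedFreeRes K (TreeEdge 2 n) (cutIdeal K 2 n) b) :
    ∀ i j : ℕ, 1 ≤ i → 1 ≤ j →
      b i (i + j) = (mandelbrot (n + 1)).coeff (j + 1) * Nat.choose (j - 1) (i - 1) := by
  intro i j hi hj
  obtain ⟨i, rfl⟩ := Nat.exists_eq_add_of_le' hi
  obtain ⟨b', hres, hb'⟩ := hasMinRes_cutIdeal K n (i + 2)
  rw [hb.betti_eq hres, hb' i j hj, Nat.add_sub_cancel]
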